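/- If G is an n-vertex graph with average degree d and no induced copy of K_{s,t}, then the clique number of G satisfies ω(G) = Ω((d^s / n^{s-1})^{s/(t(s+1)+s^2)}). -/

import Mathlib

open SimpleGraph Finset

/-- `H` occurs in `G` as an induced subgraph. -/
def HasInducedCopy {α β : Type*} (H : SimpleGraph α) (G : SimpleGraph β) : Prop :=
  Nonempty (H ↪g G)

open scoped Classical in
/-- A quantitative Ramsey bound: a vertex set containing no independent set of size `k` has at most
`k * ω ^ k` elements. -/
theorem card_le_mul_cliqueNum_pow {V : Type*} [Fintype V] (G : SimpleGraph V) (k : ℕ)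
    (B : Finset V) (h : ∀ I ⊆ B, G.IsIndepSet (I : Set V) → I.card ≠ k) :
    B.card ≤ k * G.cliqueNum ^ k := by
  induction k generalizing B with
  | zero => exact absurd rfl (h ∅ (empty_subset _) (by simp))
  | succ k ih =>
    obtain ⟨K, hK, hmax⟩ := exists_max_image
      (B.powerset.filter fun K : Finset V => G.IsClique (K : Set V)) Finset.card
      ⟨∅, by simp⟩
    simp only [mem_filter, mem_powerset] at hK hmax
    have hKω : K.card ≤ G.cliqueNum := hK.2.card_le_cliqueNum
    have hcover : B ⊆ K.biUnion fun x => insert x (B.filter fun v => ¬ G.Adj x v ∧ v ≠ x) := by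
      intro v hv
      by_contra hcon
      simp only [mem_biUnion, mem_insert, mem_filter, not_exists, not_and, not_or] at hcon
      have hvK : v ∉ K := fun hvK => (hcon v hvK).1 rfl
      have hins := hmax (insert v K) ⟨insert_subset hv hK.1, by
        rw [coe_insert, isClique_insert]
        refine ⟨hK.2, fun x hx _ => ?_⟩
        by_contra hna
        exact (hcon x hx).2 hv (fun h => hna h.symm) (hcon x hx).1⟩
      rw [card_insert_of_notMem hvK] at hins
      omega
    have hpiece : ∀ x ∈ K,
        (insert x (B.filter fun v => ¬ G.Adj x v ∧ v ≠ x)).card ≤ k * G.cliqueNum ^ k + 1 := by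
      intro x hx
      refine (card_insert_le _ _).trans (Nat.add_le_add_right (ih _ fun I hI hind hcard => ?_) 1)
      have hxI : x ∉ I := fun hxI => (mem_filter.1 (hI hxI)).2.2 rfl
      refine h (insert x I)
        (insert_subset (hK.1 hx) (hI.trans (filter_subset _ _))) ?_
        (by rw [card_insert_of_notMem hxI, hcard])
      rw [coe_insert, SimpleGraph.IsIndepSet, Set.pairwise_insert]
      refine ⟨hind, fun b hb _ => ?_⟩
      have hb' := (mem_filter.1 (hI hb)).2.1
      exact ⟨hb', fun h => hb' h.symm⟩
    calc B.card ≤ _ := card_le_card hcover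
      _ ≤ K.card * (k * G.cliqueNum ^ k + 1) := card_biUnion_le_card_mul _ _ _ hpiece
      _ ≤ G.cliqueNum * (k * G.cliqueNum ^ k + 1) := Nat.mul_le_mul_right _ hKω
      _ = k * G.cliqueNum ^ (k + 1) + G.cliqueNum := by ring
      _ ≤ k * G.cliqueNum ^ (k + 1) + G.cliqueNum ^ (k + 1) :=
          Nat.add_le_add_left (Nat.le_self_pow (Nat.succ_ne_zero k) _) _
      _ = (k + 1) * G.cliqueNum ^ (k + 1) := by ring

theorem hasInducedCopy_completeBipartiteGraph {V : Type*} {G : SimpleGraph V} {s t : ℕ}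
    {I J : Finset V} (hI : G.IsIndepSet (I : Set V)) (hJ : G.IsIndepSet (J : Set V))
    (hIs : I.card = s) (hJt : J.card = t) (hadj : ∀ x ∈ I, ∀ y ∈ J, G.Adj x y) :
    HasInducedCopy (completeBipartiteGraph (Fin s) (Fin t)) G := by
  have hindep : ∀ {K : Finset V}, G.IsIndepSet (K : Set V) → ∀ x ∈ K, ∀ y ∈ K, ¬ G.Adj x y :=
    fun hK x hx y hy hxy => hK hx hy hxy.ne hxy
  let e := (I.equivFinOfCardEq hIs).symm
  let f := (J.equivFinOfCardEq hJt).symm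
  refine ⟨⟨⟨Sum.elim (fun i => (e i : V)) (fun j => (f j : V)), ?_⟩, ?_⟩⟩
  · refine Function.Injective.sumElim (Subtype.val_injective.comp e.injective)
      (Subtype.val_injective.comp f.injective) fun i j => (hadj _ (e i).2 _ (f j).2).ne
  · rintro (i | i) (j | j)
    · simpa using hindep hI _ (e i).2 _ (e j).2
    · simpa using hadj _ (e i).2 _ (f j).2
    · simpa using (hadj _ (e j).2 _ (f i).2).symm
    · simpa using hindep hJ _ (f i).2 _ (f j).2

open scoped Classical in
/-- Double counting pairs of a vertex `u ∈ S` and an `s`-subset of an independent set `A` lying in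
the neighbourhood of `u`. -/
theorem sum_choose_le_of_not_hasInducedCopy {V : Type*} [Fintype V] {G : SimpleGraph V} {s t : ℕ}
    (hG : ¬ HasInducedCopy (completeBipartiteGraph (Fin s) (Fin t)) G) (S A : Finset V)
    (hA : G.IsIndepSet (A : Set V)) :
    ∑ u ∈ S, (A.filter fun x => G.Adj u x).card.choose s ≤
      A.card.choose s * (t * G.cliqueNum ^ t) := by
  have hchoose : ∀ u ∈ S, (A.filter fun x => G.Adj u x).card.choose s =
      ∑ I ∈ A.powersetCard s, if ∀ x ∈ I, G.Adj u x then 1 else 0 := by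
    intro u _
    rw [← card_powersetCard, ← card_filter]
    congr 1
    ext I
    simp only [mem_powersetCard, mem_filter, subset_iff]
    grind
  rw [sum_congr rfl hchoose, sum_comm, ← card_powersetCard, ← smul_eq_mul]
  refine sum_le_card_nsmul _ _ _ fun I hI => ?_
  rw [mem_powersetCard] at hI
  rw [← card_filter]
  refine card_le_mul_cliqueNum_pow G t _ fun J hJ hind hcard => hG ?_
  refine hasInducedCopy_completeBipartiteGraph (hA.mono (by exact_mod_cast hI.1)) hind hI.2 hcard
    fun x hx y hy => ?_
  exact ((mem_filter.1 (hJ hy)).2 x hx).symm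

open scoped Classical in
/-- A graph with no induced `K_{s,t}` has few vertices in terms of its clique and independence
numbers. -/
theorem card_le_of_isIndepSet_max {V : Type*} [Fintype V] {G : SimpleGraph V} {s t : ℕ}
    (hG : ¬ HasInducedCopy (completeBipartiteGraph (Fin s) (Fin t)) G)
    {S A : Finset V} (hAS : A ⊆ S) (hA : G.IsIndepSet (A : Set V)) (hApos : 0 < A.card)
    (hmax : ∀ I ⊆ S, G.IsIndepSet (I : Set V) → I.card ≤ A.card) :
    S.card ≤ A.card ^ s * (t * G.cliqueNum ^ t) + A.card +
      s * G.cliqueNum ^ s * (s * A.card ^ s) := by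
  let N : V → Finset V := fun u => A.filter fun x => G.Adj u x
  have hhigh : (S.filter fun u => s ≤ (N u).card).card ≤ A.card ^ s * (t * G.cliqueNum ^ t) := by
    calc (S.filter fun u => s ≤ (N u).card).card
        = ∑ u ∈ S.filter fun u => s ≤ (N u).card, 1 := by simp
      _ ≤ ∑ u ∈ S.filter fun u => s ≤ (N u).card, (N u).card.choose s :=
          sum_le_sum fun u hu => Nat.choose_pos (mem_filter.1 hu).2
      _ ≤ ∑ u ∈ S, (N u).card.choose s := sum_le_sum_of_subset (filter_subset _ _)
      _ ≤ A.card.choose s * (t * G.cliqueNum ^ t) := sum_choose_le_of_not_hasInducedCopy hG S A hA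
      _ ≤ _ := Nat.mul_le_mul_right _ (Nat.choose_le_pow _ _)
  have hlow : ((S \ A).filter fun u => (N u).card < s).card ≤
      s * G.cliqueNum ^ s * (s * A.card ^ s) := by
    have himage : ((range s).biUnion fun j => A.powersetCard j).card ≤ s * A.card ^ s := by
      have := card_biUnion_le_card_mul (range s) (fun j => A.powersetCard j) (A.card ^ s)
        fun j hj => by
          rw [card_powersetCard]
          exact (Nat.choose_le_pow _ _).trans
            (Nat.pow_le_pow_right hApos (mem_range.1 hj).le)
      rwa [card_range] at this
    refine (card_le_mul_card_image_of_maps_to (f := N)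
      (t := (range s).biUnion fun j => A.powersetCard j) (fun u hu => ?_) (s * G.cliqueNum ^ s)
      fun T hT => ?_).trans (Nat.mul_le_mul_left _ himage)
    · simp only [mem_biUnion, mem_range, mem_powersetCard]
      exact ⟨_, (mem_filter.1 hu).2, filter_subset _ _, rfl⟩
    · simp only [mem_biUnion, mem_range, mem_powersetCard] at hT
      obtain ⟨j, hj, hTA, hTj⟩ := hT
      refine card_le_mul_cliqueNum_pow G s _ fun I hI hind hcard => ?_
      have hI' : ∀ u ∈ I, u ∈ S ∧ u ∉ A ∧ N u = T := by
        intro u hu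
        have := hI hu
        simp only [mem_filter, mem_sdiff] at this
        exact ⟨this.1.1.1, this.1.1.2, this.2⟩
      have hdisj : Disjoint (A \ T) I :=
        disjoint_left.2 fun x hx hxI => (hI' x hxI).2.1 (mem_sdiff.1 hx).1
      have hcross : ∀ u ∈ I, ∀ x ∈ A \ T, ¬ G.Adj u x := by
        intro u hu x hx hux
        rw [mem_sdiff] at hx
        exact hx.2 ((hI' u hu).2.2 ▸ mem_filter.2 ⟨hx.1, hux⟩)
      have hcard' := hmax ((A \ T) ∪ I)
        (union_subset (sdiff_subset.trans hAS) fun u hu => (hI' u hu).1) (by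
          rw [coe_union, SimpleGraph.IsIndepSet, Set.pairwise_union]
          refine ⟨hA.mono (by exact_mod_cast sdiff_subset), hind, fun x hx u hu _ => ?_⟩
          have := hcross u hu x hx
          exact ⟨fun h => this h.symm, this⟩)
      rw [card_union_of_disjoint hdisj, card_sdiff_of_subset hTA] at hcard'
      have := card_le_card hTA
      omega
  have hcover : S ⊆ (S.filter fun u => s ≤ (N u).card) ∪ A ∪
      ((S \ A).filter fun u => (N u).card < s) := by
    intro u hu
    simp only [mem_union, mem_filter, mem_sdiff]
    by_cases huA : u ∈ A
    · simp [huA]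
    · rcases le_or_gt s (N u).card with h | h <;> simp [hu, huA, h]
  calc S.card ≤ _ := card_le_card hcover
    _ ≤ _ := card_union_le _ _
    _ ≤ _ := Nat.add_le_add ((card_union_le _ _).trans (Nat.add_le_add_right hhigh _)) hlow

open scoped Classical in
/-- A vertex set of minimum degree at least `δ` containing an independent set of size
`m ≥ 2s|S|/δ`. -/
theorem card_le_of_isIndepSet_of_le_degree {V : Type*} [Fintype V] {G : SimpleGraph V} {s t : ℕ}
    (hs : 0 < s) (hG : ¬ HasInducedCopy (completeBipartiteGraph (Fin s) (Fin t)) G)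
    {S A : Finset V} {δ : ℝ} (hAS : A ⊆ S) (hA : G.IsIndepSet (A : Set V))
    (hdeg : ∀ v ∈ S, δ ≤ (S.filter fun u => G.Adj v u).card)
    (hAδ : 2 * s * S.card ≤ A.card * δ) :
    S.card ≤ A.card ^ s * (t * G.cliqueNum ^ t) := by
  have hchoose : ∀ x : ℕ, x ≤ x.choose s + s := by
    intro x
    induction x with
    | zero => simp
    | succ x ih =>
      rcases lt_or_ge x s with h | h
      · omega
      · obtain ⟨r, rfl⟩ : ∃ r, s = r + 1 := ⟨s - 1, by omega⟩
        have := Nat.choose_pos (show r ≤ x by omega)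
        rw [Nat.choose_succ_succ']
        omega
  have hcount : ∑ v ∈ A, (S.filter fun u => G.Adj v u).card =
      ∑ u ∈ S, (A.filter fun x => G.Adj u x).card := by
    simp only [card_filter]
    rw [sum_comm]
    simp only [G.adj_comm]
  have h₁ : (A.card : ℝ) * δ ≤ ∑ u ∈ S, ((A.filter fun x => G.Adj u x).card : ℝ) := by
    have := card_nsmul_le_sum A (fun v => ((S.filter fun u => G.Adj v u).card : ℝ)) δ
      fun v hv => hdeg v (hAS hv)
    rw [nsmul_eq_mul] at this
    exact this.trans (by exact_mod_cast hcount.le)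
  have h₂ : ∑ u ∈ S, (A.filter fun x => G.Adj u x).card ≤
      ∑ u ∈ S, (A.filter fun x => G.Adj u x).card.choose s + S.card * s := by
    rw [← smul_eq_mul, ← sum_const, ← sum_add_distrib]
    exact sum_le_sum fun u _ => hchoose _
  have h₃ : 2 * s * S.card ≤ ∑ u ∈ S, (A.filter fun x => G.Adj u x).card := by
    exact_mod_cast hAδ.trans h₁
  have h₄ := (sum_choose_le_of_not_hasInducedCopy hG S A hA).trans
    (Nat.mul_le_mul_right _ (Nat.choose_le_pow _ _))
  nlinarith [Nat.mul_le_mul_right S.card hs]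

open scoped Classical in
/-- Every graph has a nonempty vertex set inducing minimum degree at least half the average
degree. -/
theorem exists_subset_half_le_degree {V : Type*} (G : SimpleGraph V) {D : ℝ}
    (U : Finset V) (hne : U.Nonempty)
    (hU : D * U.card ≤ ∑ v ∈ U, ((U.filter fun u => G.Adj v u).card : ℝ)) :
    ∃ S : Finset V, S.Nonempty ∧ ∀ v ∈ S, D / 2 ≤ (S.filter fun u => G.Adj v u).card := by
  induction U using Finset.strongInduction with
  | H U ih =>
    by_cases hall : ∀ v ∈ U, D / 2 ≤ (U.filter fun u => G.Adj v u).card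
    · exact ⟨U, hne, hall⟩
    push Not at hall
    obtain ⟨w, hw, hlt⟩ := hall
    have hsplit : ∀ v, ((U.filter fun u => G.Adj v u).card : ℝ) =
        ((U.erase w).filter fun u => G.Adj v u).card + if G.Adj v w then 1 else 0 := by
      intro v
      simp only [card_filter]
      push_cast
      rw [← sum_erase_add _ _ hw]
    have hcol : ∑ v ∈ U.erase w, (if G.Adj v w then (1 : ℝ) else 0) =
        (U.filter fun u => G.Adj w u).card := by
      rw [hsplit w, card_filter]
      simp [G.adj_comm]
    have hsum : ∑ v ∈ U, ((U.filter fun u => G.Adj v u).card : ℝ) =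
        ∑ v ∈ U.erase w, (((U.erase w).filter fun u => G.Adj v u).card : ℝ) +
          2 * (U.filter fun u => G.Adj w u).card := by
      rw [← sum_erase_add _ _ hw, sum_congr rfl fun v _ => hsplit v, sum_add_distrib, hcol]
      ring
    have hcard : (U.card : ℝ) = (U.erase w).card + 1 := by
      exact_mod_cast (card_erase_add_one hw).symm
    rw [hsum, hcard] at hU
    refine ih _ (erase_ssubset hw) ?_ (by linarith)
    by_contra hempty
    rw [not_nonempty_iff_eq_empty] at hempty
    rw [hempty] at hU
    simp at hU
    linarith

open scoped Classical in
theorem card_mul_pow_le_of_le_degree {V : Type*} [Fintype V] {G : SimpleGraph V} {s t : ℕ}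
    (hs : 0 < s) (hG : ¬ HasInducedCopy (completeBipartiteGraph (Fin s) (Fin t)) G)
    {S : Finset V} (hne : S.Nonempty) {δ : ℝ} (hδ : 0 < δ)
    (hdeg : ∀ v ∈ S, δ ≤ (S.filter fun u => G.Adj v u).card) :
    S.card * δ ^ s ≤
      (t + 1 + s ^ 2) * (G.cliqueNum : ℝ) ^ (s + t) * ((2 * s + 1) * S.card) ^ s := by
  obtain ⟨v₀, hv₀⟩ := hne
  have hω : 1 ≤ G.cliqueNum := by
    have : G.IsClique (({v₀} : Finset V) : Set V) := by simp
    simpa using this.card_le_cliqueNum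
  have hδS : δ ≤ S.card := (hdeg v₀ hv₀).trans (by exact_mod_cast card_filter_le _ _)
  have hSpos : 0 < S.card := card_pos.2 ⟨v₀, hv₀⟩
  set m : ℕ := ⌈2 * s * S.card / δ⌉₊ with hm
  have hm_lower : 2 * s * S.card ≤ (m : ℝ) * δ := by
    rw [← div_le_iff₀ hδ]
    exact Nat.le_ceil _
  have hm_upper : (m : ℝ) * δ ≤ (2 * s + 1) * S.card := by
    have := (Nat.ceil_lt_add_one (a := 2 * s * S.card / δ) (by positivity)).le
    rw [← hm] at this
    calc (m : ℝ) * δ ≤ (2 * s * S.card / δ + 1) * δ := by gcongr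
      _ = 2 * s * S.card + δ := by field_simp
      _ ≤ _ := by linarith
  have hpow_t : G.cliqueNum ^ t ≤ G.cliqueNum ^ (s + t) :=
    Nat.pow_le_pow_right hω (by omega)
  have hpow_s : G.cliqueNum ^ s ≤ G.cliqueNum ^ (s + t) :=
    Nat.pow_le_pow_right hω (by omega)
  have hpow_one : 1 ≤ G.cliqueNum ^ (s + t) := Nat.one_le_pow _ _ hω
  have hkey : S.card ≤ (t + 1 + s ^ 2) * G.cliqueNum ^ (s + t) * m ^ s := by
    obtain ⟨A, hA, hmax⟩ := exists_max_image
      (S.powerset.filter fun I : Finset V => G.IsIndepSet (I : Set V)) Finset.card ⟨∅, by simp⟩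
    simp only [mem_filter, mem_powerset] at hA hmax
    rcases le_total A.card m with hAm | hmA
    · have hApos : 0 < A.card := by
        have := hmax {v₀} ⟨by simpa using hv₀, by simp⟩
        simpa using this
      calc S.card ≤ A.card ^ s * (t * G.cliqueNum ^ t) + A.card +
            s * G.cliqueNum ^ s * (s * A.card ^ s) :=
            card_le_of_isIndepSet_max hG hA.1 hA.2 hApos fun I hI hind => hmax I ⟨hI, hind⟩
        _ ≤ A.card ^ s * (t * G.cliqueNum ^ (s + t)) + A.card ^ s * G.cliqueNum ^ (s + t) +
            s * G.cliqueNum ^ (s + t) * (s * A.card ^ s) := by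
            gcongr
            calc A.card ≤ A.card ^ s := Nat.le_self_pow hs.ne' _
              _ ≤ _ := Nat.le_mul_of_pos_right _ hpow_one
        _ = (t + 1 + s ^ 2) * G.cliqueNum ^ (s + t) * A.card ^ s := by ring
        _ ≤ _ := by gcongr
    · obtain ⟨A', hA'A, hA'm⟩ := exists_subset_card_eq hmA
      have := card_le_of_isIndepSet_of_le_degree hs hG (hA'A.trans hA.1)
        (hA.2.mono (by exact_mod_cast hA'A)) hdeg (by rw [hA'm]; exact hm_lower)
      rw [hA'm] at this
      calc S.card ≤ m ^ s * (t * G.cliqueNum ^ t) := this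
        _ ≤ m ^ s * ((t + 1 + s ^ 2) * G.cliqueNum ^ (s + t)) := by
            gcongr
            omega
        _ = _ := by ring
  calc S.card * δ ^ s
      ≤ ((t + 1 + s ^ 2) * G.cliqueNum ^ (s + t) * m ^ s : ℝ) * δ ^ s := by
        gcongr
        exact_mod_cast hkey
    _ = (t + 1 + s ^ 2) * (G.cliqueNum : ℝ) ^ (s + t) * (m * δ) ^ s := by ring
    _ ≤ _ := by gcongr

/-- An induced Kővári–Sós–Turán bound, polynomial in the clique number. -/
theorem pow_div_pow_le_cliqueNum_pow {s t n : ℕ} (hs : 0 < s) (G : SimpleGraph (Fin n))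
    [DecidableRel G.Adj] (hG : ¬ HasInducedCopy (completeBipartiteGraph (Fin s) (Fin t)) G)
    {d : ℝ} (hd : d = 2 * (G.edgeFinset.card : ℝ) / n) (hdpos : 0 < d) (hn : 0 < n) :
    d ^ s / (n : ℝ) ^ (s - 1) ≤
      2 ^ s * (t + 1 + s ^ 2) * (2 * s + 1) ^ s * (G.cliqueNum : ℝ) ^ (s + t) := by
  classical
  have hn' : (0 : ℝ) < n := by exact_mod_cast hn
  have hsum : d * (univ : Finset (Fin n)).card ≤
      ∑ v ∈ univ, ((univ.filter fun u => G.Adj v u).card : ℝ) := by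
    have hdegree := G.sum_degrees_eq_twice_card_edges
    have : ∀ v, (univ.filter fun u => G.Adj v u).card = G.degree v := by
      intro v
      rw [← card_neighborFinset_eq_degree, neighborFinset_eq_filter]
    simp only [this]
    rw [← Nat.cast_sum, hdegree, hd, card_univ, Fintype.card_fin, div_mul_cancel₀ _ hn'.ne']
    push_cast
    rfl
  obtain ⟨S, hne, hdeg⟩ := exists_subset_half_le_degree G univ
    (card_pos.1 (by simpa using hn)) (by convert hsum)
  have hS : 0 < (S.card : ℝ) := by exact_mod_cast card_pos.2 hne
  have hSn : (S.card : ℝ) ≤ n := by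
    have := card_le_univ S
    rw [Fintype.card_fin] at this
    exact_mod_cast this
  have hmain := card_mul_pow_le_of_le_degree hs hG hne (half_pos hdpos) (by convert hdeg)
  rw [div_le_iff₀ (by positivity)]
  obtain ⟨r, rfl⟩ : ∃ r, s = r + 1 := ⟨s - 1, by omega⟩
  rw [Nat.add_sub_cancel]
  have hmain' : (S.card : ℝ) * d ^ (r + 1) ≤ S.card *
      (2 ^ (r + 1) * (t + 1 + (r + 1 : ℕ) ^ 2) * (2 * (r + 1 : ℕ) + 1) ^ (r + 1) *
        (G.cliqueNum : ℝ) ^ (r + 1 + t) * (S.card : ℝ) ^ r) := by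
    calc (S.card : ℝ) * d ^ (r + 1) = 2 ^ (r + 1) * (S.card * (d / 2) ^ (r + 1)) := by
          rw [div_pow]
          field_simp
      _ ≤ 2 ^ (r + 1) * _ := mul_le_mul_of_nonneg_left hmain (by positivity)
      _ = _ := by
          rw [mul_pow, pow_succ (S.card : ℝ)]
          ring
  refine (le_of_mul_le_mul_left hmain' hS).trans ?_
  gcongr

/-- **Corollary.** If `G` has average degree `d = 2e(G)/n` and no induced `K_{s,t}`, then
`ω(G) = Ω((d^s/n^{s-1})^{s/(t(s+1)+s²)})`, the constant depending only on `s` and `t`. -/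
theorem stmt8 (s t : ℕ) (hs : 0 < s) (ht : 0 < t) :
    ∃ c > (0 : ℝ), ∀ (n : ℕ) (G : SimpleGraph (Fin n)) [DecidableRel G.Adj] (d : ℝ),
      d = 2 * (G.edgeFinset.card : ℝ) / n →
      ¬ HasInducedCopy (completeBipartiteGraph (Fin s) (Fin t)) G →
      c * (d ^ s / (n : ℝ) ^ (s - 1)) ^ ((s : ℝ) / (t * (s + 1) + s ^ 2 : ℝ)) ≤
        (G.cliqueNum : ℝ) := by
  have hs' : (0 : ℝ) < s := by exact_mod_cast hs
  have ht' : (0 : ℝ) < t := by exact_mod_cast ht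
  set a : ℝ := (s : ℝ) / (t * (s + 1) + s ^ 2 : ℝ) with ha
  have hapos : 0 < a := by positivity
  set C : ℝ := 2 ^ s * (t + 1 + s ^ 2) * (2 * s + 1) ^ s with hC
  have hCpos : 0 < C := by positivity
  refine ⟨(C ^ a)⁻¹, by positivity, fun n G _ d hd hG => ?_⟩
  have hdnonneg : 0 ≤ d := by rw [hd]; positivity
  rcases hdnonneg.eq_or_lt with hd0 | hdpos
  · rw [← hd0, zero_pow hs.ne', zero_div, Real.zero_rpow hapos.ne', mul_zero]
    positivity
  have hn : 0 < n := by
    rcases Nat.eq_zero_or_pos n with rfl | h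
    · simp at hd
      linarith
    · exact h
  have hω : (1 : ℝ) ≤ G.cliqueNum := by
    have : G.IsClique (({⟨0, hn⟩} : Finset (Fin n)) : Set (Fin n)) := by simp
    exact_mod_cast (by simpa using this.card_le_cliqueNum : 1 ≤ G.cliqueNum)
  have hexp : ((s + t : ℕ) : ℝ) * a ≤ 1 := by
    rw [ha, mul_div_assoc', div_le_one (by positivity)]
    push_cast
    nlinarith
  rw [inv_mul_le_iff₀ (by positivity)]
  calc (d ^ s / (n : ℝ) ^ (s - 1)) ^ a ≤ (C * (G.cliqueNum : ℝ) ^ (s + t)) ^ a :=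
        Real.rpow_le_rpow (by positivity)
          (pow_div_pow_le_cliqueNum_pow hs G hG hd hdpos hn) hapos.le
    _ = C ^ a * (G.cliqueNum : ℝ) ^ (((s + t : ℕ) : ℝ) * a) := by
        rw [Real.mul_rpow hCpos.le (by positivity), ← Real.rpow_natCast_mul (by positivity)]
    _ ≤ C ^ a * (G.cliqueNum : ℝ) ^ (1 : ℝ) := by
        gcongr
    _ = C ^ a * G.cliqueNum := by rw [Real.rpow_one]
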